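/- arXiv:2506.16704 — 2 statements merged into one kernel-verified Lean document; each statement's English description precedes it below -/
import Mathlib

section
/- There exists an absolute constant C > 0 with the following property (uniform convergence for partial concepts). Let Z be a measurable space and let F be a countable class of partial concepts f : Z → {0,1,⊥} such that {z : f(z) = 1} and {z : f(z) = 0} are measurable for each f ∈ F, and assume VCdim(F) = d is finite. For every integer n ≥ 2 and every δ ∈ (0,1/2), set γ := C·(d·(log n)² + log(1/δ))/n. Then for every probability distribution P on Z, the probability over n i.i.d. points z_1, …, z_n drawn from P that there exists f ∈ F with P{z : f(z) = 1} > γ and f(z_i) = 0 for all i ∈ [n] is at most δ. -/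
open MeasureTheory
open scoped ENNReal

/-- A finite set `S` is shattered by a class `F` of partial concepts
`f : Z → {0,1,⊥}` (encoded as `Z → Option Bool`, with `⊥ = none`). -/
def PShatters {Z : Type*} (F : Set (Z → Option Bool)) (S : Finset Z) : Prop :=
  ∀ E ⊆ S, ∃ f ∈ F, (∀ s ∈ E, f s = some false) ∧ ∀ s ∈ S, s ∉ E → f s = some true

/-- The VC dimension of a class of partial concepts. -/
noncomputable def PVCdim {Z : Type*} (F : Set (Z → Option Bool)) : ℕ∞ :=
  ⨆ (S : Finset Z) (_ : PShatters F S), (S.card : ℕ∞)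

section Combinatorics

variable {ι : Type*}

theorem PShatters.empty_of_nonempty {H : Set (ι → Option Bool)} (hH : H.Nonempty) :
    PShatters H ∅ := by
  obtain ⟨f, hf⟩ := hH
  intro E hE
  rw [Finset.subset_empty] at hE
  exact ⟨f, hf, by simp [hE], by simp⟩

theorem PShatters.mono {H K : Set (ι → Option Bool)} (h : H ⊆ K) {S : Finset ι}
    (hS : PShatters H S) : PShatters K S := by
  intro E hE
  obtain ⟨f, hf, h₀⟩ := hS E hE
  exact ⟨f, h hf, h₀⟩

/-- The members of a class of partial concepts that take the value `b` at `x`. -/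
def labelRestrict (H : Set (ι → Option Bool)) (x : ι) (b : Bool) : Set (ι → Option Bool) :=
  {f ∈ H | f x = some b}

theorem notMem_of_pShatters_labelRestrict {H : Set (ι → Option Bool)} {x : ι} {b : Bool}
    {S : Finset ι} (hS : PShatters (labelRestrict H x b) S) : x ∉ S := by
  intro hx
  cases b
  · obtain ⟨f, hf, -, h₁⟩ := hS ∅ (by simp)
    have := h₁ x hx (by simp)
    simp [hf.2] at this
  · obtain ⟨f, hf, h₀, -⟩ := hS S subset_rfl
    have := h₀ x hx
    simp [hf.2] at this

theorem PShatters.insert_of_labelRestrict [DecidableEq ι] {H : Set (ι → Option Bool)} {x : ι}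
    {S : Finset ι} (h₀ : PShatters (labelRestrict H x false) S)
    (h₁ : PShatters (labelRestrict H x true) S) : PShatters H (insert x S) := by
  intro E hE
  have hsub : E.erase x ⊆ S := by
    rwa [← Finset.subset_insert_iff]
  by_cases hx : x ∈ E
  · obtain ⟨f, hf, hE₀, hE₁⟩ := h₀ _ hsub
    refine ⟨f, hf.1, fun s hs => ?_, fun s hs hsE => ?_⟩
    · by_cases h : s = x
      · exact h ▸ hf.2
      · exact hE₀ s (Finset.mem_erase.2 ⟨h, hs⟩)
    · have h : s ≠ x := fun h => hsE (h ▸ hx)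
      exact hE₁ s (Finset.mem_of_mem_insert_of_ne hs h)
        fun h' => hsE (Finset.mem_of_mem_erase h')
  · obtain ⟨f, hf, hE₀, hE₁⟩ := h₁ _ hsub
    refine ⟨f, hf.1, fun s hs => ?_, fun s hs hsE => ?_⟩
    · exact hE₀ s (Finset.mem_erase.2 ⟨fun h => hx (h ▸ hs), hs⟩)
    · by_cases h : s = x
      · exact h ▸ hf.2
      · exact hE₁ s (Finset.mem_of_mem_insert_of_ne hs h)
          fun h' => hsE (Finset.mem_of_mem_erase h')

open Classical in
/-- The number of sets shattered by a class of partial concepts on a finite domain. -/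
noncomputable def shatterCount [Fintype ι] (H : Set (ι → Option Bool)) : ℕ :=
  (Finset.univ.filter fun S : Finset ι => PShatters H S).card

theorem shatterCount_labelRestrict_add_le [Fintype ι] (H : Set (ι → Option Bool)) (x : ι) :
    shatterCount (labelRestrict H x false) + shatterCount (labelRestrict H x true)
      ≤ shatterCount H := by
  classical
  have hsub : ∀ b, labelRestrict H x b ⊆ H := fun b f hf => hf.1
  set A : Bool → Finset (Finset ι) := fun b =>
    Finset.univ.filter fun S => PShatters (labelRestrict H x b) S with hA
  have hmem : ∀ {b S}, S ∈ A b ↔ PShatters (labelRestrict H x b) S := by simp [hA]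
  have hins : Set.InjOn (insert x) (↑(A false ∩ A true) : Set (Finset ι)) := by
    intro S hS T hT h
    have hS' := notMem_of_pShatters_labelRestrict
      (hmem.1 (Finset.mem_inter.1 (Finset.mem_coe.1 hS)).1)
    have hT' := notMem_of_pShatters_labelRestrict
      (hmem.1 (Finset.mem_inter.1 (Finset.mem_coe.1 hT)).1)
    rw [← Finset.erase_insert hS', ← Finset.erase_insert hT', h]
  have hdisj : Disjoint (A false ∪ A true) ((A false ∩ A true).image (insert x)) := by
    rw [Finset.disjoint_left]
    intro S hS hS'
    obtain ⟨T, -, rfl⟩ := Finset.mem_image.1 hS'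
    rcases Finset.mem_union.1 hS with h | h <;>
      exact notMem_of_pShatters_labelRestrict (hmem.1 h) (Finset.mem_insert_self _ _)
  calc (A false).card + (A true).card
      = (A false ∪ A true).card + (A false ∩ A true).card :=
        (Finset.card_union_add_card_inter _ _).symm
    _ = ((A false ∪ A true) ∪ (A false ∩ A true).image (insert x)).card := by
        rw [Finset.card_union_of_disjoint hdisj, Finset.card_image_of_injOn hins]
    _ ≤ shatterCount H := by
        refine Finset.card_le_card fun S hS => Finset.mem_filter.2 ⟨Finset.mem_univ _, ?_⟩
        rcases Finset.mem_union.1 hS with h | h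
        · rcases Finset.mem_union.1 h with h | h <;> exact (hmem.1 h).mono (hsub _)
        · obtain ⟨T, hT, rfl⟩ := Finset.mem_image.1 h
          rw [Finset.mem_inter] at hT
          exact (hmem.1 hT.1).insert_of_labelRestrict (hmem.1 hT.2)

theorem shatterCount_pos [Fintype ι] {H : Set (ι → Option Bool)} (hH : H.Nonempty) :
    0 < shatterCount H := by
  classical
  exact Finset.card_pos.2
    ⟨∅, Finset.mem_filter.2 ⟨Finset.mem_univ _, PShatters.empty_of_nonempty hH⟩⟩

theorem shatterCount_le [Fintype ι] {H : Set (ι → Option Bool)} {d : ℕ}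
    (hd : ∀ S, PShatters H S → S.card ≤ d) :
    shatterCount H ≤ (Fintype.card ι + 1) ^ d := by
  classical
  calc shatterCount H
      ≤ ((Finset.univ : Finset (Fin d → Option ι)).image fun u =>
          Finset.univ.filter fun i => ∃ j, u j = some i).card := by
        refine Finset.card_le_card fun S hS => Finset.mem_image.2 ?_
        have hS := hd S (Finset.mem_filter.1 hS).2
        refine ⟨fun j => S.toList[j.1]?, Finset.mem_univ _, ?_⟩
        ext i
        rw [Finset.mem_filter_univ, ← Finset.mem_toList, List.mem_iff_getElem?]
        refine ⟨fun ⟨j, hj⟩ => ⟨j, hj⟩, fun ⟨j, hj⟩ => ⟨⟨j, ?_⟩, hj⟩⟩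
        obtain ⟨hlt, -⟩ := List.getElem?_eq_some_iff.1 hj
        rw [Finset.length_toList] at hlt
        omega
    _ ≤ (Finset.univ : Finset (Fin d → Option ι)).card := Finset.card_image_le
    _ = (Fintype.card ι + 1) ^ d := by simp

/-- A class of partial concepts with few shattered sets has a small disambiguation. -/
theorem exists_disambiguation_on_list [Fintype ι] (l : List ι) :
    ∀ (k : ℕ) (H : Set (ι → Option Bool)), shatterCount H < 2 ^ (k + 1) →
      ∃ G : Finset (ι → Bool), G.card ≤ (l.length + 1) ^ k ∧
        ∀ f ∈ H, ∃ g ∈ G, ∀ i ∈ l, ∀ b, f i = some b → g i = b := by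
  classical
  induction l with
  | nil => exact fun k H _ => ⟨{fun _ => false}, by simp, by simp⟩
  | cons x l ih =>
    intro k H hH
    obtain ⟨b, hb⟩ : ∃ b, shatterCount (labelRestrict H x b) < 2 ^ k := by
      by_contra! h
      have := shatterCount_labelRestrict_add_le H x
      have h₀ := h false
      have h₁ := h true
      rw [pow_succ] at hH
      omega
    obtain ⟨G, hG, hcov⟩ := ih k H hH
    have hstep : ∀ {f : ι → Option Bool} {g : ι → Bool} {c : Bool},
        (∀ i ∈ l, ∀ b, f i = some b → g i = b) → (∀ b, f x = some b → c = b) →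
        ∀ i ∈ x :: l, ∀ b, f i = some b → Function.update g x c i = b := by
      intro f g c hg hc i hi b' hf
      by_cases hix : i = x
      · subst hix
        simpa using hc b' hf
      · rw [Function.update_of_ne hix]
        exact hg i ((List.mem_cons.1 hi).resolve_left hix) b' hf
    have hmaj : ∀ f ∈ H, f x ≠ some b → ∃ g ∈ G.image fun g => Function.update g x (!b),
        ∀ i ∈ x :: l, ∀ b, f i = some b → g i = b := by
      intro f hf hfx
      obtain ⟨g, hg, hfg⟩ := hcov f hf
      refine ⟨_, Finset.mem_image_of_mem _ hg, hstep hfg fun b' hb' => ?_⟩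
      have : b' ≠ b := fun h => hfx (h ▸ hb')
      revert this
      cases b <;> cases b' <;> simp
    rcases k with _ | k
    · refine ⟨G.image fun g => Function.update g x (!b),
        Finset.card_image_le.trans (by simpa using hG), fun f hf => hmaj f hf fun hfx => ?_⟩
      have := shatterCount_pos (H := labelRestrict H x b) ⟨f, hf, hfx⟩
      simp at hb
      omega
    · obtain ⟨G', hG', hcov'⟩ := ih k (labelRestrict H x b) hb
      refine ⟨(G.image fun g => Function.update g x (!b)) ∪
        G'.image fun g => Function.update g x b, ?_, fun f hf => ?_⟩
      · calc _ ≤ G.card + G'.card :=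
              (Finset.card_union_le _ _).trans
                (add_le_add Finset.card_image_le Finset.card_image_le)
          _ ≤ (l.length + 1) ^ (k + 1) + (l.length + 1) ^ k := add_le_add hG hG'
          _ = (l.length + 2) * (l.length + 1) ^ k := by ring
          _ ≤ (l.length + 2) * (l.length + 2) ^ k := by gcongr; omega
          _ = ((x :: l).length + 1) ^ (k + 1) := by
              rw [List.length_cons, pow_succ]; ring
      · by_cases hfx : f x = some b
        · obtain ⟨g, hg, hfg⟩ := hcov' f ⟨hf, hfx⟩
          refine ⟨_, Finset.mem_union_right _ (Finset.mem_image_of_mem _ hg),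
            hstep hfg fun b' hb' => ?_⟩
          rw [hfx] at hb'
          exact Option.some_injective _ hb'
        · obtain ⟨g, hg, hfg⟩ := hmaj f hf hfx
          exact ⟨g, Finset.mem_union_left _ hg, hfg⟩

theorem exists_disambiguation [Fintype ι] {H : Set (ι → Option Bool)} {d : ℕ}
    (hd : ∀ S, PShatters H S → S.card ≤ d) :
    ∃ G : Finset (ι → Bool),
      G.card ≤ (Fintype.card ι + 1) ^ Nat.log 2 ((Fintype.card ι + 1) ^ d) ∧
        ∀ f ∈ H, ∃ g ∈ G, ∀ i b, f i = some b → g i = b := by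
  obtain ⟨G, hG, hcov⟩ := exists_disambiguation_on_list (Finset.univ : Finset ι).toList
    (Nat.log 2 ((Fintype.card ι + 1) ^ d)) H
    ((shatterCount_le hd).trans_lt (Nat.lt_pow_succ_log_self one_lt_two _))
  refine ⟨G, by simpa using hG, fun f hf => ?_⟩
  obtain ⟨g, hg, h⟩ := hcov f hf
  exact ⟨g, hg, fun i => h i (by simp)⟩

theorem PShatters.image_of_comp {Z : Type*} [DecidableEq Z] {F : Set (Z → Option Bool)}
    {p : ι → Z} {S : Finset ι} (hS : PShatters ((fun f => f ∘ p) '' F) S) :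
    Set.InjOn p S ∧ PShatters F (S.image p) := by
  classical
  refine ⟨fun i hi j hj hij => ?_, fun E hE => ?_⟩
  · by_contra hne
    obtain ⟨_, ⟨f, -, rfl⟩, h₀, h₁⟩ := hS {i} (by simpa using hi)
    have hf₀ := h₀ i (by simp)
    have hf₁ := h₁ j hj (by simpa using Ne.symm hne)
    simp [Function.comp_apply, hij] at hf₀ hf₁
    simp [hf₀] at hf₁
  · obtain ⟨_, ⟨f, hf, rfl⟩, h₀, h₁⟩ := hS (S.filter fun i => p i ∈ E) (Finset.filter_subset _ _)
    refine ⟨f, hf, fun s hs => ?_, fun s hs hsE => ?_⟩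
    · obtain ⟨i, hi, rfl⟩ := Finset.mem_image.1 (hE hs)
      exact h₀ i (Finset.mem_filter.2 ⟨hi, hs⟩)
    · obtain ⟨i, hi, rfl⟩ := Finset.mem_image.1 hs
      exact h₁ i hi fun h => hsE (Finset.mem_filter.1 h).2

theorem PShatters.card_le_of_comp {Z : Type*} {F : Set (Z → Option Bool)} {d : ℕ}
    (hd : PVCdim F ≤ d) {p : ι → Z} {S : Finset ι}
    (hS : PShatters ((fun f => f ∘ p) '' F) S) : S.card ≤ d := by
  classical
  obtain ⟨hinj, hsh⟩ := hS.image_of_comp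
  rw [← Finset.card_image_of_injOn hinj]
  exact_mod_cast (le_iSup₂ (f := fun (S : Finset Z) (_ : PShatters F S) => (S.card : ℕ∞))
    _ hsh).trans hd

end Combinatorics

section Symmetrization

/-- The weight of a pair of labels: zero unless the first is `0`, and doubled if the second
is `1`. -/
noncomputable def pairWeight (a b : Option Bool) : ℝ≥0∞ :=
  if a = some false then (if b = some true then 2 else 1) else 0

theorem pairWeight_le {a b : Option Bool} {a' b' : Bool} (ha : ∀ c, a = some c → a' = c)
    (hb : ∀ c, b = some c → b' = c) : pairWeight a b ≤ pairWeight (some a') (some b') := by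
  unfold pairWeight
  split_ifs <;> simp_all

theorem pairWeight_add_swap_le (a b : Bool) :
    pairWeight (some a) (some b) + pairWeight (some b) (some a) ≤ 2 := by
  cases a <;> cases b <;> simp [pairWeight, one_add_one_eq_two]

/-- The `b`-th component of a pair. -/
def pairProj {Z : Type*} (w : Z × Z) (b : Bool) : Z := bif b then w.2 else w.1

theorem sum_prod_pairWeight_le {n : ℕ} (g : Fin n × Bool → Bool) :
    ∑ σ : Fin n → Bool, ∏ i, pairWeight (some (g (i, σ i))) (some (g (i, !σ i))) ≤ 2 ^ n := by
  classical
  have h := Finset.prod_univ_sum (fun _ : Fin n => (Finset.univ : Finset Bool))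
    fun i b => pairWeight (some (g (i, b))) (some (g (i, !b)))
  rw [Fintype.piFinset_univ] at h
  rw [← h]
  calc _ ≤ ∏ _i : Fin n, (2 : ℝ≥0∞) := by
        refine Finset.prod_le_prod' fun i _ => ?_
        rw [Fintype.sum_bool]
        exact pairWeight_add_swap_le _ _
    _ = 2 ^ n := by simp

/-- The supremum over the class of the product weight of a double sample. -/
noncomputable def classWeight {Z : Type*} {n : ℕ} (F : Set (Z → Option Bool))
    (w : Fin n → Z × Z) : ℝ≥0∞ :=
  ⨆ f ∈ F, ∏ i, pairWeight (f (w i).1) (f (w i).2)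

/-- Swap the two components of a pair when `b` holds. -/
def swapIf {Z : Type*} (b : Bool) (w : Z × Z) : Z × Z := (pairProj w b, pairProj w !b)

theorem sum_classWeight_swap_le {Z : Type*} {n d : ℕ} {F : Set (Z → Option Bool)}
    (hd : PVCdim F ≤ d) (w : Fin n → Z × Z) :
    ∑ σ : Fin n → Bool, classWeight F (fun i => swapIf (σ i) (w i))
      ≤ ((2 * n + 1) ^ Nat.log 2 ((2 * n + 1) ^ d) : ℕ) * 2 ^ n := by
  obtain ⟨G, hG, hcov⟩ := exists_disambiguation
    (H := (fun f => f ∘ fun q : Fin n × Bool => pairProj (w q.1) q.2) '' F)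
    (d := d) fun S hS => hS.card_le_of_comp hd
  have hcard : Fintype.card (Fin n × Bool) = 2 * n := by simp [mul_comm]
  rw [hcard] at hG
  calc ∑ σ : Fin n → Bool, classWeight F (fun i => swapIf (σ i) (w i))
      ≤ ∑ σ : Fin n → Bool, ∑ g ∈ G,
          ∏ i, pairWeight (some (g (i, σ i))) (some (g (i, !σ i))) := by
        refine Finset.sum_le_sum fun σ _ => iSup₂_le fun f hf => ?_
        obtain ⟨g, hg, hfg⟩ := hcov _ ⟨f, hf, rfl⟩
        exact (Finset.prod_le_prod' fun i _ =>
          pairWeight_le (fun c hc => hfg (i, σ i) c hc) (fun c hc => hfg (i, !σ i) c hc)).trans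
          (Finset.single_le_sum (f := fun g : Fin n × Bool → Bool =>
            ∏ i, pairWeight (some (g (i, σ i))) (some (g (i, !σ i)))) (fun _ _ => zero_le) hg)
    _ = ∑ g ∈ G, ∑ σ : Fin n → Bool,
          ∏ i, pairWeight (some (g (i, σ i))) (some (g (i, !σ i))) := Finset.sum_comm
    _ ≤ ∑ _g ∈ G, (2 : ℝ≥0∞) ^ n := Finset.sum_le_sum fun g _ => sum_prod_pairWeight_le g
    _ = (G.card : ℝ≥0∞) * 2 ^ n := by rw [Finset.sum_const, nsmul_eq_mul]
    _ ≤ _ := by gcongr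

variable {Z : Type*} [MeasurableSpace Z]

theorem measurable_pairWeight {f : Z → Option Bool}
    (hf : MeasurableSet {z | f z = some true} ∧ MeasurableSet {z | f z = some false}) :
    Measurable fun w : Z × Z => pairWeight (f w.1) (f w.2) :=
  Measurable.ite (measurable_fst hf.2)
    (Measurable.ite (measurable_snd hf.1) measurable_const measurable_const) measurable_const

theorem measurable_classWeight {F : Set (Z → Option Bool)} (hF : F.Countable)
    (hm : ∀ f ∈ F, MeasurableSet {z | f z = some true} ∧ MeasurableSet {z | f z = some false})
    (n : ℕ) : Measurable (classWeight (n := n) F) :=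
  Measurable.biSup F hF fun f hf => Finset.measurable_fun_prod _ fun i _ =>
    (measurable_pairWeight (hm f hf)).comp (measurable_pi_apply i)

theorem measurePreserving_swapIf (P : Measure Z) [IsProbabilityMeasure P] (b : Bool) :
    MeasurePreserving (swapIf b) (P.prod P) (P.prod P) := by
  cases b
  · exact MeasurePreserving.id _
  · exact Measure.measurePreserving_swap

theorem lintegral_classWeight_le {n d : ℕ} {F : Set (Z → Option Bool)} (hF : F.Countable)
    (hm : ∀ f ∈ F, MeasurableSet {z | f z = some true} ∧ MeasurableSet {z | f z = some false})
    (hd : PVCdim F ≤ d) (P : Measure Z) [IsProbabilityMeasure P] :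
    ∫⁻ w, classWeight F w ∂(Measure.pi fun _ : Fin n => P.prod P)
      ≤ ((2 * n + 1) ^ Nat.log 2 ((2 * n + 1) ^ d) : ℕ) := by
  set ν := Measure.pi fun _ : Fin n => P.prod P
  have hmeas := measurable_classWeight hF hm n
  have hpres : ∀ σ : Fin n → Bool,
      MeasurePreserving (fun (w : Fin n → Z × Z) i => swapIf (σ i) (w i)) ν ν := fun σ =>
    measurePreserving_pi _ _ fun i => measurePreserving_swapIf P (σ i)
  have hsum : 2 ^ n * ∫⁻ w, classWeight F w ∂ν
      ≤ ((2 * n + 1) ^ Nat.log 2 ((2 * n + 1) ^ d) : ℕ) * 2 ^ n := by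
    calc 2 ^ n * ∫⁻ w, classWeight F w ∂ν
        = ∑ σ : Fin n → Bool, ∫⁻ w, classWeight F (fun i => swapIf (σ i) (w i)) ∂ν := by
          rw [Finset.sum_congr rfl fun σ _ => (hpres σ).lintegral_comp hmeas]
          simp
      _ = ∫⁻ w, ∑ σ : Fin n → Bool, classWeight F (fun i => swapIf (σ i) (w i)) ∂ν :=
          (lintegral_finsetSum _ fun σ _ => hmeas.comp (hpres σ).measurable).symm
      _ ≤ ∫⁻ _, ((2 * n + 1) ^ Nat.log 2 ((2 * n + 1) ^ d) : ℕ) * 2 ^ n ∂ν :=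
          lintegral_mono fun w => sum_classWeight_swap_le hd w
      _ = _ := by simp
  rw [mul_comm] at hsum
  exact (ENNReal.mul_le_mul_iff_left (by simp) (by simp)).1 hsum

theorem lintegral_pi_prod {n : ℕ} (P : Measure Z) [IsProbabilityMeasure P] {u : Z → ℝ≥0∞}
    (hu : Measurable u) :
    ∫⁻ z, ∏ i, u (z i) ∂(Measure.pi fun _ : Fin n => P) = (∫⁻ z, u z ∂P) ^ n := by
  rw [ProbabilityTheory.lintegral_prod_eq_prod_lintegral_of_indepFun Finset.univ
    (fun i (z : Fin n → Z) => u (z i))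
    (ProbabilityTheory.iIndepFun_pi fun i => hu.aemeasurable)
    fun i => hu.comp (measurable_pi_apply i)]
  simp [fun i => (measurePreserving_eval (fun _ : Fin n => P) i).lintegral_comp hu]

theorem lintegral_two_ite (P : Measure Z) [IsProbabilityMeasure P] {f : Z → Option Bool}
    (hf : MeasurableSet {z | f z = some true}) :
    ∫⁻ z, (if f z = some true then 2 else 1) ∂P = 1 + P {z | f z = some true} := by
  have h : ∀ z, (if f z = some true then 2 else 1 : ℝ≥0∞)
      = 1 + {z | f z = some true}.indicator 1 z := by
    intro z
    by_cases hz : f z = some true <;> simp [hz, one_add_one_eq_two]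
  simp_rw [h]
  rw [lintegral_add_left measurable_const, lintegral_indicator_one hf]
  simp

theorem one_add_pow_mul_measure_le {n d : ℕ} {F : Set (Z → Option Bool)} (hF : F.Countable)
    (hm : ∀ f ∈ F, MeasurableSet {z | f z = some true} ∧ MeasurableSet {z | f z = some false})
    (hd : PVCdim F ≤ d) (P : Measure Z) [IsProbabilityMeasure P] (γ : ℝ) :
    (1 + ENNReal.ofReal γ) ^ n * (Measure.pi fun _ : Fin n => P)
        {zs | ∃ f ∈ F, γ < (P {z | f z = some true}).toReal ∧ ∀ i, f (zs i) = some false}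
      ≤ ((2 * n + 1) ^ Nat.log 2 ((2 * n + 1) ^ d) : ℕ) := by
  set μ := Measure.pi fun _ : Fin n => P
  set e := MeasurableEquiv.arrowProdEquivProdArrow Z Z (Fin n)
  have he : MeasurePreserving e (Measure.pi fun _ : Fin n => P.prod P) (μ.prod μ) :=
    measurePreserving_arrowProdEquivProdArrow Z Z (Fin n) (fun _ => P) fun _ => P
  have hmeas : Measurable fun q : (Fin n → Z) × (Fin n → Z) =>
      classWeight F fun i => (q.1 i, q.2 i) :=
    (measurable_classWeight hF hm n).comp e.symm.measurable
  have hint : ∫⁻ z, ∫⁻ z', classWeight F (fun i => (z i, z' i)) ∂μ ∂μ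
      ≤ ((2 * n + 1) ^ Nat.log 2 ((2 * n + 1) ^ d) : ℕ) := by
    rw [← lintegral_prod (fun q : (Fin n → Z) × (Fin n → Z) =>
      classWeight F fun i => (q.1 i, q.2 i)) hmeas.aemeasurable, ← he.lintegral_comp hmeas]
    exact lintegral_classWeight_le hF hm hd P
  refine le_trans ?_ ((mul_meas_ge_le_lintegral₀ hmeas.lintegral_prod_right'.aemeasurable
    ((1 + ENNReal.ofReal γ) ^ n)).trans hint)
  gcongr with zs
  rintro ⟨f, hf, hγ, h0⟩
  calc (1 + ENNReal.ofReal γ) ^ n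
      ≤ (1 + P {z | f z = some true}) ^ n := by
        gcongr
        exact ENNReal.ofReal_le_of_le_toReal hγ.le
    _ = ∫⁻ z', ∏ i, (if f (z' i) = some true then 2 else 1) ∂μ := by
        rw [← lintegral_two_ite P (hm f hf).1]
        exact (lintegral_pi_prod P
          (Measurable.ite (hm f hf).1 measurable_const measurable_const)).symm
    _ ≤ ∫⁻ z', classWeight F (fun i => (zs i, z' i)) ∂μ := by
        refine lintegral_mono fun z' => le_iSup₂_of_le f hf (le_of_eq ?_)
        simp [pairWeight, h0]

end Symmetrization

theorem exp_half_le_one_add {x : ℝ} (h₀ : 0 ≤ x) (h₁ : x ≤ 1) : Real.exp (x / 2) ≤ 1 + x := by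
  have h := Real.add_one_le_exp (-(x / 2))
  rw [Real.exp_neg] at h
  have hpos := Real.exp_pos (x / 2)
  have h' : (1 - x / 2) * Real.exp (x / 2) ≤ 1 := by
    calc (1 - x / 2) * Real.exp (x / 2) ≤ (Real.exp (x / 2))⁻¹ * Real.exp (x / 2) := by
          gcongr; linarith
      _ = 1 := inv_mul_cancel₀ hpos.ne'
  nlinarith [mul_le_mul_of_nonneg_left h' (by linarith : 0 ≤ 1 + x),
    mul_nonneg (mul_nonneg h₀ (sub_nonneg.2 h₁)) hpos.le]

theorem log_disambiguation_bound_le {n : ℕ} (hn : 2 ≤ n) (d : ℕ) :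
    Real.log ((2 * n + 1) ^ Nat.log 2 ((2 * n + 1) ^ d) : ℕ) ≤ 18 * (d * Real.log n ^ 2) := by
  have hn' : (2 : ℝ) ≤ n := by exact_mod_cast hn
  set L := Real.log (2 * n + 1 : ℕ) with hL
  have hL₀ : 0 ≤ L := Real.log_natCast_nonneg _
  have hL₃ : L ≤ 3 * Real.log n := by
    have : L ≤ Real.log ((n : ℝ) ^ 3) := by
      refine Real.log_le_log (by positivity) ?_
      push_cast
      nlinarith [mul_nonneg (sub_nonneg.2 hn') (sub_nonneg.2 hn'), sq_nonneg ((n : ℝ) + 1)]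
    rwa [Real.log_pow] at this
  have hk : (Nat.log 2 ((2 * n + 1) ^ d) : ℝ) * (1 / 2) ≤ d * L := by
    calc (Nat.log 2 ((2 * n + 1) ^ d) : ℝ) * (1 / 2)
        ≤ Nat.log 2 ((2 * n + 1) ^ d) * Real.log 2 := by
          gcongr
          linarith [Real.log_two_gt_d9]
      _ = Real.log ((2 ^ Nat.log 2 ((2 * n + 1) ^ d) : ℕ) : ℝ) := by
          push_cast; rw [Real.log_pow]
      _ ≤ Real.log (((2 * n + 1) ^ d : ℕ) : ℝ) := by
          refine Real.log_le_log (by positivity) ?_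
          exact_mod_cast Nat.pow_log_le_self 2 (by positivity)
      _ = d * L := by rw [Nat.cast_pow, Real.log_pow]
  rw [Nat.cast_pow, Real.log_pow]
  have hsq : L * L ≤ (3 * Real.log n) * (3 * Real.log n) := by gcongr
  have hd : (0 : ℝ) ≤ d := d.cast_nonneg
  nlinarith [mul_le_mul_of_nonneg_right hk hL₀, mul_le_mul_of_nonneg_left hsq hd]

/-- Lemma 4.3, uniform convergence for partial concepts: there is an
absolute constant `C > 0` such that for every countable class `F` of partial concepts
with measurable level sets and `VCdim(F) = d`, every `n ≥ 2`, `δ ∈ (0,1/2)`, and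
`γ := C (d log² n + log(1/δ)) / n`, and every probability distribution `P` on `Z`,
the probability over `n` i.i.d. points that some `f ∈ F` has `P{f = 1} > γ` while
`f(z_i) = 0` for all `i` is at most `δ`. -/
theorem uniform_convergence_partial_concepts :
    ∃ C : ℝ, 0 < C ∧
    ∀ (Z : Type) [MeasurableSpace Z] (F : Set (Z → Option Bool)) (d : ℕ),
      F.Countable →
      (∀ f ∈ F, MeasurableSet {z | f z = some true} ∧ MeasurableSet {z | f z = some false}) →
      PVCdim F = (d : ℕ∞) →
      ∀ n : ℕ, 2 ≤ n → ∀ δ : ℝ, δ ∈ Set.Ioo (0:ℝ) (1/2) →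
      ∀ P : Measure Z, IsProbabilityMeasure P →
        (Measure.pi fun _ : Fin n => P)
          {zs : Fin n → Z |
            ∃ f ∈ F, C * ((d : ℝ) * (Real.log n) ^ 2 + Real.log (1 / δ)) / n <
                (P {z | f z = some true}).toReal ∧ ∀ i, f (zs i) = some false}
          ≤ ENNReal.ofReal δ := by
  refine ⟨36, by norm_num, ?_⟩
  intro Z _ F d hF hm hd n hn δ hδ P _
  have hn₀ : (0 : ℝ) < n := by exact_mod_cast (by omega : 0 < n)
  have hlog : 0 < Real.log (1 / δ) :=
    Real.log_pos (by rw [lt_div_iff₀ hδ.1]; linarith [hδ.2])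
  set γ : ℝ := 36 * ((d : ℝ) * Real.log n ^ 2 + Real.log (1 / δ)) / n with hγ
  have hγ₀ : 0 ≤ γ := by positivity
  rcases lt_or_ge 1 γ with h1 | h1
  · refine ((congrArg _ (Set.eq_empty_of_forall_notMem ?_)).trans measure_empty).trans_le zero_le
    rintro zs ⟨f, -, hf, -⟩
    have : (P {z | f z = some true}).toReal ≤ 1 := measureReal_le_one
    linarith
  have hbound := one_add_pow_mul_measure_le (n := n) hF hm hd.le P γ
  set N : ℕ := (2 * n + 1) ^ Nat.log 2 ((2 * n + 1) ^ d) with hN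
  have hN₀ : (0 : ℝ) < N := by positivity
  have hreal : (N : ℝ) ≤ (1 + γ) ^ n * δ := by
    have hexp : Real.exp (n * (γ / 2)) ≤ (1 + γ) ^ n := by
      rw [Real.exp_nat_mul]
      gcongr
      exact exp_half_le_one_add hγ₀ h1
    have hNlog := log_disambiguation_bound_le hn d
    have hng : n * (γ / 2) = 18 * ((d : ℝ) * Real.log n ^ 2 + Real.log (1 / δ)) := by
      rw [hγ]; field_simp; ring
    calc (N : ℝ) = Real.exp (Real.log N) := (Real.exp_log hN₀).symm
      _ ≤ Real.exp (n * (γ / 2) - Real.log (1 / δ)) := by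
          gcongr
          rw [hng]
          linarith
      _ = Real.exp (n * (γ / 2)) * δ := by
          rw [Real.exp_sub, Real.exp_log (by have := hδ.1; positivity)]
          simp
      _ ≤ (1 + γ) ^ n * δ := by
          have := hδ.1
          gcongr
  have hbase : (1 + ENNReal.ofReal γ) ^ n = ENNReal.ofReal ((1 + γ) ^ n) := by
    rw [ENNReal.ofReal_pow (by positivity), ENNReal.ofReal_add zero_le_one hγ₀,
      ENNReal.ofReal_one]
  rw [hbase] at hbound
  have hpos : 0 < (1 + γ) ^ n := by positivity
  refine (ENNReal.mul_le_mul_iff_right (ENNReal.ofReal_pos.2 hpos).ne'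
    ENNReal.ofReal_ne_top).1 (hbound.trans ?_)
  rw [← ENNReal.ofReal_mul hpos.le, ← ENNReal.ofReal_natCast]
  exact ENNReal.ofReal_le_ofReal hreal
end

section
/- Let H be a class of hypotheses h : X → {0,1}, let τ, α ∈ (0,1), and let D', D_1, D_2 be domains with d_{H,τ}(D_1, D') ≤ α/2 and d_{H,τ}(D_2, D') ≤ α/2. Then for every h ∈ H with err_{D_1}(h) ≤ τ − α, it holds that err_{D_2}(h) ≤ τ. In particular, there is no h ∈ H with err_{D_1}(h) < τ − α and err_{D_2}(h) > τ. -/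
open MeasureTheory
open scoped ENNReal

/-- The error of hypothesis `h` on domain `D`: `err_D(h) = Pr_{(x,y)~D}[y ≠ h(x)]`. -/
noncomputable def errD {X : Type*} [MeasurableSpace (X × Bool)]
    (D : Measure (X × Bool)) (h : X → Bool) : ℝ :=
  (D {p : X × Bool | p.2 ≠ h p.1}).toReal

/-- `S` is `α`-shattered by `H` at threshold `τ`. -/
def AlphaShattered {X : Type*} [MeasurableSpace (X × Bool)]
    (H : Set (X → Bool)) (S : Set (Measure (X × Bool))) (τ α : ℝ) : Prop :=
  ∀ E ⊆ S, ∃ h ∈ H, (∀ D ∈ E, errD D h < τ - α) ∧ ∀ D ∈ S \ E, τ < errD D h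

/-- The domain shattering dimension `Gdim(H, G, τ, α)`. -/
noncomputable def Gdim {X : Type*} [MeasurableSpace (X × Bool)]
    (H : Set (X → Bool)) (G : Set (Measure (X × Bool))) (τ α : ℝ) : ℕ∞ :=
  ⨆ (S : Finset (Measure (X × Bool)))
    (_ : (S : Set (Measure (X × Bool))) ⊆ G ∧
      AlphaShattered H (S : Set (Measure (X × Bool))) τ α),
    (S.card : ℕ∞)


/-- The `(H, τ)`-divergence
`d_{H,τ}(D, D') := sup { |err_D(h) - err_{D'}(h)| : h ∈ H, min(err_D(h), err_{D'}(h)) ≤ τ }`. -/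
noncomputable def dHtau {X : Type*} [MeasurableSpace (X × Bool)]
    (H : Set (X → Bool)) (τ : ℝ) (D D' : Measure (X × Bool)) : ℝ :=
  sSup {r : ℝ | ∃ h ∈ H, min (errD D h) (errD D' h) ≤ τ ∧ r = |errD D h - errD D' h|}

/-- The error on a probability domain lies in `[0, 1]`. -/
theorem errD_mem_Icc {X : Type*} [MeasurableSpace (X × Bool)]
    (D : Measure (X × Bool)) [IsProbabilityMeasure D] (h : X → Bool) :
    errD D h ∈ Set.Icc (0 : ℝ) 1 :=
  ⟨ENNReal.toReal_nonneg, measureReal_le_one⟩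

/-- Each hypothesis admitted in the supremum contributes at most the divergence. -/
theorem abs_errD_sub_le_dHtau {X : Type*} [MeasurableSpace (X × Bool)]
    {H : Set (X → Bool)} {τ : ℝ} (D D' : Measure (X × Bool))
    [IsProbabilityMeasure D] [IsProbabilityMeasure D'] {h : X → Bool} (hh : h ∈ H)
    (hmin : min (errD D h) (errD D' h) ≤ τ) :
    |errD D h - errD D' h| ≤ dHtau H τ D D' := by
  refine le_csSup ⟨1, ?_⟩ ⟨h, hh, hmin, rfl⟩
  rintro r ⟨g, -, -, rfl⟩
  obtain ⟨h0, h1⟩ := errD_mem_Icc D g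
  obtain ⟨h0', h1'⟩ := errD_mem_Icc D' g
  rw [abs_le]
  constructor <;> linarith

/-- key step of Theorem 6.1: if `d_{H,τ}(D₁, D') ≤ α/2` and
`d_{H,τ}(D₂, D') ≤ α/2`, then every `h ∈ H` with `err_{D₁}(h) ≤ τ - α` has
`err_{D₂}(h) ≤ τ`; in particular no `h ∈ H` has `err_{D₁}(h) < τ - α` and
`err_{D₂}(h) > τ`. -/
theorem cover_triangle_bound {X : Type*} [MeasurableSpace (X × Bool)]
    (H : Set (X → Bool)) (τ α : ℝ)
    (hτ : τ ∈ Set.Ioo (0:ℝ) 1) (hα : α ∈ Set.Ioo (0:ℝ) 1)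
    (D' D1 D2 : Measure (X × Bool))
    [IsProbabilityMeasure D'] [IsProbabilityMeasure D1] [IsProbabilityMeasure D2]
    (h1 : dHtau H τ D1 D' ≤ α / 2) (h2 : dHtau H τ D2 D' ≤ α / 2) :
    (∀ h ∈ H, errD D1 h ≤ τ - α → errD D2 h ≤ τ) ∧
    ¬∃ h ∈ H, errD D1 h < τ - α ∧ τ < errD D2 h := by
  have key : ∀ h ∈ H, errD D1 h ≤ τ - α → errD D2 h ≤ τ := by
    intro h hh hle
    have hα0 := hα.1
    have hd1 := abs_le.1 ((abs_errD_sub_le_dHtau D1 D' hh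
      (min_le_of_left_le (by linarith : errD D1 h ≤ τ))).trans h1)
    have hd2 := abs_le.1 ((abs_errD_sub_le_dHtau D2 D' hh
      (min_le_of_right_le (by linarith [hd1.1] : errD D' h ≤ τ))).trans h2)
    linarith [hd1.1, hd2.2]
  exact ⟨key, fun ⟨h, hh, hlt, hgt⟩ => (key h hh hlt.le).not_gt hgt⟩
end
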